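/- arXiv:2203.04509 — 2 statements merged into one kernel-verified Lean document; each statement's English description precedes it below -/
import Mathlib

section
/- Let Ω ⊆ ℝ³ be open and let f : Ω → ℍ be a C⁴ function. If f is inframonogenic (∂̄f∂̄ = 0) or antiinframonogenic (∂f∂ = 0), then every real component fᵢ (i = 0,1,2,3) of f is biharmonic, i.e. Δ²fᵢ = 0. -/
open Quaternion

noncomputable section

abbrev R3 := Fin 3 → ℝ

/-- Partial derivative `∂ᵢ` in the coordinate direction `i`. -/
noncomputable def pd {E : Type*} [NormedAddCommGroup E] [NormedSpace ℝ E]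
    (i : Fin 3) (f : R3 → E) (x : R3) : E :=
  fderiv ℝ f x (Pi.single i 1)

/-- The quaternion unit `e₁`. -/
def e1 : ℍ[ℝ] := ⟨0,1,0,0⟩
/-- The quaternion unit `e₂`. -/
def e2 : ℍ[ℝ] := ⟨0,0,1,0⟩
/-- The quaternion unit `e₃`. -/
def e3 : ℍ[ℝ] := ⟨0,0,0,1⟩

/-- The units `e₀ = 1, e₁, e₂`. -/
def eu : Fin 3 → ℍ[ℝ] := ![1, e1, e2]
/-- The signs `ε₀ = 1, ε₁ = ε₂ = −1`. -/
def eps : Fin 3 → ℝ := ![1, -1, -1]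

/-- The two-sided operator `∂̄f∂̄ = Σᵢⱼ eᵢ(∂ᵢ∂ⱼf)eⱼ`. -/
noncomputable def sandwichBar (f : R3 → ℍ[ℝ]) (x : R3) : ℍ[ℝ] :=
  ∑ i : Fin 3, ∑ j : Fin 3, eu i * pd i (pd j f) x * eu j

/-- The two-sided operator `∂f∂ = Σᵢⱼ εᵢεⱼ eᵢ(∂ᵢ∂ⱼf)eⱼ`. -/
noncomputable def sandwich (f : R3 → ℍ[ℝ]) (x : R3) : ℍ[ℝ] :=
  ∑ i : Fin 3, ∑ j : Fin 3, (eps i * eps j) • (eu i * pd i (pd j f) x * eu j)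

/-- The Laplacian `Δ = ∂₀² + ∂₁² + ∂₂²`. -/
noncomputable def lap {E : Type*} [NormedAddCommGroup E] [NormedSpace ℝ E]
    (f : R3 → E) (x : R3) : E :=
  pd 0 (pd 0 f) x + pd 1 (pd 1 f) x + pd 2 (pd 2 f) x

/-- The left Cauchy–Riemann operator `∂̄f = ∂₀f + e₁(∂₁f) + e₂(∂₂f)`. -/
noncomputable def DbarL (f : R3 → ℍ[ℝ]) (x : R3) : ℍ[ℝ] :=
  pd 0 f x + e1 * pd 1 f x + e2 * pd 2 f x

/-- The left conjugate Cauchy–Riemann operator `∂f = ∂₀f − e₁(∂₁f) − e₂(∂₂f)`. -/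
noncomputable def DL (f : R3 → ℍ[ℝ]) (x : R3) : ℍ[ℝ] :=
  pd 0 f x - e1 * pd 1 f x - e2 * pd 2 f x

/-- The right Cauchy–Riemann operator `f∂̄ = ∂₀f + (∂₁f)e₁ + (∂₂f)e₂`. -/
noncomputable def DbarR (f : R3 → ℍ[ℝ]) (x : R3) : ℍ[ℝ] :=
  pd 0 f x + pd 1 f x * e1 + pd 2 f x * e2

/-- The right conjugate Cauchy–Riemann operator `f∂ = ∂₀f − (∂₁f)e₁ − (∂₂f)e₂`. -/
noncomputable def DR (f : R3 → ℍ[ℝ]) (x : R3) : ℍ[ℝ] :=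
  pd 0 f x - pd 1 f x * e1 - pd 2 f x * e2

section DiracOperators

variable {E F : Type*} [NormedAddCommGroup E] [NormedSpace ℝ E]
  [NormedAddCommGroup F] [NormedSpace ℝ F] {Ω : Set R3}

lemma pd_congr (hΩ : IsOpen Ω) {f g : R3 → E} (h : Set.EqOn f g Ω) (i : Fin 3) :
    Set.EqOn (pd i f) (pd i g) Ω := fun x hx => by
  have : f =ᶠ[nhds x] g := Filter.eventuallyEq_of_mem (hΩ.mem_nhds hx) h
  simp only [pd, this.fderiv_eq]

lemma lap_congr (hΩ : IsOpen Ω) {f g : R3 → E} (h : Set.EqOn f g Ω) :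
    Set.EqOn (lap f) (lap g) Ω := fun x hx => by
  simp only [lap, pd_congr hΩ (pd_congr hΩ h _) _ hx]

lemma pd_add {f g : R3 → E} {x : R3} (hf : DifferentiableAt ℝ f x)
    (hg : DifferentiableAt ℝ g x) (i : Fin 3) :
    pd i (fun y => f y + g y) x = pd i f x + pd i g x := by
  simp only [pd, fderiv_fun_add hf hg, add_apply]

lemma pd_clm (L : E →L[ℝ] F) {f : R3 → E} {x : R3} (hf : DifferentiableAt ℝ f x)
    (i : Fin 3) : pd i (fun y => L (f y)) x = L (pd i f x) := by
  have : fderiv ℝ (fun y => L (f y)) x = L.comp (fderiv ℝ f x) :=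
    (L.hasFDerivAt.comp x hf.hasFDerivAt).fderiv
  simp only [pd, this, ContinuousLinearMap.comp_apply]

lemma ContDiffOn.pd (hΩ : IsOpen Ω) {f : R3 → E} {m n : WithTop ℕ∞}
    (hf : ContDiffOn ℝ n f Ω) (hmn : m + 1 ≤ n) (i : Fin 3) :
    ContDiffOn ℝ m (pd i f) Ω :=
  (hf.fderiv_of_isOpen hΩ hmn).clm_apply contDiffOn_const

lemma ContDiffOn.differentiableAt_of_isOpen (hΩ : IsOpen Ω) {f : R3 → E} {n : WithTop ℕ∞}
    (hf : ContDiffOn ℝ n f Ω) (hn : n ≠ 0) {x : R3} (hx : x ∈ Ω) :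
    DifferentiableAt ℝ f x :=
  (hf.contDiffAt (hΩ.mem_nhds hx)).differentiableAt hn

lemma ContDiffOn.differentiableAt_pd (hΩ : IsOpen Ω) {f : R3 → E}
    (hf : ContDiffOn ℝ 2 f Ω) {x : R3} (hx : x ∈ Ω) (i : Fin 3) :
    DifferentiableAt ℝ (_root_.pd i f) x :=
  (hf.pd hΩ (m := 1) (by norm_num) i).differentiableAt_of_isOpen hΩ one_ne_zero hx

lemma pd_comm (hΩ : IsOpen Ω) {f : R3 → E} (hf : ContDiffOn ℝ 2 f Ω) {x : R3}
    (hx : x ∈ Ω) (i j : Fin 3) : pd i (pd j f) x = pd j (pd i f) x := by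
  have hfx := hf.contDiffAt (hΩ.mem_nhds hx)
  have hd : DifferentiableAt ℝ (fderiv ℝ f) x :=
    (hfx.fderiv_right (m := 1) (by norm_num)).differentiableAt one_ne_zero
  have key (i j : Fin 3) :
      pd i (pd j f) x = fderiv ℝ (fderiv ℝ f) x (Pi.single i 1) (Pi.single j 1) :=
    pd_clm (ContinuousLinearMap.apply ℝ E (Pi.single j 1 : R3)) hd i
  rw [key, key]
  exact (hfx.isSymmSndFDerivAt (by simp)).eq _ _

/-- The first-order operator `∂₀ + A∂₁ + B∂₂` with operator coefficients `A` and `B`. -/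
def dirac (A B : E →L[ℝ] E) (f : R3 → E) (x : R3) : E :=
  pd 0 f x + A (pd 1 f x) + B (pd 2 f x)

lemma dirac_congr (hΩ : IsOpen Ω) (A B : E →L[ℝ] E) {f g : R3 → E} (h : Set.EqOn f g Ω) :
    Set.EqOn (dirac A B f) (dirac A B g) Ω := fun x hx => by
  simp only [dirac, pd_congr hΩ h _ hx]

lemma ContDiffOn.dirac (hΩ : IsOpen Ω) (A B : E →L[ℝ] E) {f : R3 → E} {m n : WithTop ℕ∞}
    (hf : ContDiffOn ℝ n f Ω) (hmn : m + 1 ≤ n) : ContDiffOn ℝ m (dirac A B f) Ω :=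
  ((hf.pd hΩ hmn 0).add (A.contDiff.comp_contDiffOn (hf.pd hΩ hmn 1))).add
    (B.contDiff.comp_contDiffOn (hf.pd hΩ hmn 2))

lemma ContDiffOn.lap (hΩ : IsOpen Ω) {f : R3 → E} {m n : WithTop ℕ∞}
    (hf : ContDiffOn ℝ n f Ω) (hmn : m + 1 + 1 ≤ n) : ContDiffOn ℝ m (lap f) Ω :=
  have h (i : Fin 3) := (hf.pd hΩ hmn i).pd hΩ le_rfl i
  ((h 0).add (h 1)).add (h 2)

lemma pd_dirac (hΩ : IsOpen Ω) (A B : E →L[ℝ] E) {f : R3 → E} (hf : ContDiffOn ℝ 2 f Ω)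
    {x : R3} (hx : x ∈ Ω) (i : Fin 3) :
    pd i (dirac A B f) x = pd i (pd 0 f) x + A (pd i (pd 1 f) x) + B (pd i (pd 2 f) x) := by
  have h := hf.differentiableAt_pd hΩ hx
  have hA : DifferentiableAt ℝ (fun y => A (pd 1 f y)) x :=
    A.differentiableAt.comp x (h 1)
  have hB : DifferentiableAt ℝ (fun y => B (pd 2 f y)) x :=
    B.differentiableAt.comp x (h 2)
  have := pd_add ((h 0).fun_add hA) hB i
  rw [pd_add (h 0) hA, pd_clm A (h 1), pd_clm B (h 2)] at this
  exact this

lemma pd_dirac_comm (hΩ : IsOpen Ω) (A B : E →L[ℝ] E) {f : R3 → E}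
    (hf : ContDiffOn ℝ 2 f Ω) (i : Fin 3) :
    Set.EqOn (pd i (dirac A B f)) (dirac A B (pd i f)) Ω := fun x hx => by
  rw [pd_dirac hΩ A B hf hx, dirac]
  simp only [pd_comm hΩ hf hx i]

lemma lap_dirac_comm (hΩ : IsOpen Ω) (A B : E →L[ℝ] E) {f : R3 → E}
    (hf : ContDiffOn ℝ 3 f Ω) :
    Set.EqOn (lap (dirac A B f)) (dirac A B (lap f)) Ω := fun x hx => by
  have hp (i : Fin 3) : ContDiffOn ℝ 2 (pd i f) Ω := hf.pd hΩ (by norm_num) i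
  have h2 (i : Fin 3) : pd i (pd i (dirac A B f)) x = dirac A B (pd i (pd i f)) x := by
    rw [pd_congr hΩ (pd_dirac_comm hΩ A B (hf.of_le (by norm_num)) i) i hx]
    exact pd_dirac_comm hΩ A B (hp i) i hx
  have hl (j : Fin 3) : pd j (lap f) x
      = pd j (pd 0 (pd 0 f)) x + pd j (pd 1 (pd 1 f)) x + pd j (pd 2 (pd 2 f)) x := by
    have h (i : Fin 3) := (hp i).differentiableAt_pd hΩ hx i
    have := pd_add ((h 0).fun_add (h 1)) (h 2) j
    rw [pd_add (h 0) (h 1)] at this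
    exact this
  rw [lap, h2, h2, h2]
  simp only [dirac, hl, map_add]
  abel

/-- Anticommuting square roots of `-1` as coefficients factor the Laplacian. -/
lemma dirac_neg_dirac (hΩ : IsOpen Ω) {A B : E →L[ℝ] E} (hA : ∀ v, A (A v) = -v)
    (hB : ∀ v, B (B v) = -v) (hAB : ∀ v, A (B v) = -B (A v)) {f : R3 → E}
    (hf : ContDiffOn ℝ 2 f Ω) :
    Set.EqOn (dirac (-A) (-B) (dirac A B f)) (lap f) Ω := fun x hx => by
  rw [dirac]
  simp only [pd_dirac hΩ A B hf hx, lap, neg_apply, map_add, hA, hB, hAB,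
    pd_comm hΩ hf hx 1 0, pd_comm hΩ hf hx 2 0, pd_comm hΩ hf hx 2 1]
  abel

lemma pd_zero (i : Fin 3) (x : R3) : pd i (fun _ => (0 : E)) x = 0 := by
  simp [pd]

lemma dirac_zero (A B : E →L[ℝ] E) (x : R3) : dirac A B (fun _ => (0 : E)) x = 0 := by
  simp [dirac, pd_zero]

lemma lap_lap_eq_zero_of_dirac_dirac (hΩ : IsOpen Ω) {A B P Q : E →L[ℝ] E}
    (hA : ∀ v, A (A v) = -v) (hB : ∀ v, B (B v) = -v) (hAB : ∀ v, A (B v) = -B (A v))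
    (hP : ∀ v, P (P v) = -v) (hQ : ∀ v, Q (Q v) = -v) (hPQ : ∀ v, P (Q v) = -Q (P v))
    {f : R3 → E} (hf : ContDiffOn ℝ 4 f Ω)
    (h : ∀ x ∈ Ω, dirac A B (dirac P Q f) x = 0) : ∀ x ∈ Ω, lap (lap f) x = 0 := by
  have h1 : ∀ x ∈ Ω, dirac P Q (lap f) x = 0 := fun x hx => by
    rw [← lap_dirac_comm hΩ P Q (hf.of_le (by norm_num)) hx,
      ← dirac_neg_dirac hΩ hA hB hAB (hf.dirac hΩ P Q (by norm_num)) hx,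
      dirac_congr hΩ _ _ h hx, dirac_zero]
  intro x hx
  rw [← dirac_neg_dirac hΩ hP hQ hPQ (hf.lap hΩ (by norm_num)) hx,
    dirac_congr hΩ _ _ h1 hx, dirac_zero]

lemma lap_clm (hΩ : IsOpen Ω) (L : E →L[ℝ] F) {f : R3 → E} (hf : ContDiffOn ℝ 2 f Ω) :
    Set.EqOn (lap fun y => L (f y)) (fun y => L (lap f y)) Ω := fun x hx => by
  have h (i : Fin 3) : pd i (pd i fun y => L (f y)) x = L (pd i (pd i f) x) := by
    have h1 : Set.EqOn (pd i fun y => L (f y)) (fun y => L (pd i f y)) Ω := fun y hy =>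
      pd_clm L (hf.differentiableAt_of_isOpen hΩ two_ne_zero hy) i
    rw [pd_congr hΩ h1 i hx, pd_clm L (hf.differentiableAt_pd hΩ hx i)]
  simp only [lap, h, map_add]

lemma lap_lap_clm_eq_zero (hΩ : IsOpen Ω) (L : E →L[ℝ] F) {f : R3 → E}
    (hf : ContDiffOn ℝ 4 f Ω) {x : R3} (hx : x ∈ Ω) (h : lap (lap f) x = 0) :
    lap (lap fun y => L (f y)) x = 0 := by
  rw [lap_congr hΩ (lap_clm hΩ L (hf.of_le (by norm_num))) hx,
    lap_clm hΩ L (hf.lap hΩ (by norm_num)) hx]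
  simp only [h, map_zero]

end DiracOperators

/-- Left multiplication by a quaternion. -/
def mulL (a : ℍ[ℝ]) : ℍ[ℝ] →L[ℝ] ℍ[ℝ] := ContinuousLinearMap.mul ℝ ℍ[ℝ] a

/-- Right multiplication by a quaternion. -/
def mulR (a : ℍ[ℝ]) : ℍ[ℝ] →L[ℝ] ℍ[ℝ] := (ContinuousLinearMap.mul ℝ ℍ[ℝ]).flip a

lemma mulL_apply (a v : ℍ[ℝ]) : mulL a v = a * v := rfl

lemma mulR_apply (a v : ℍ[ℝ]) : mulR a v = v * a := rfl

lemma e1_mul_e1 : e1 * e1 = -1 := by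
  ext <;>
    simp only [Quaternion.re_mul, Quaternion.imI_mul, Quaternion.imJ_mul, Quaternion.imK_mul] <;>
    simp [e1]

lemma e2_mul_e2 : e2 * e2 = -1 := by
  ext <;>
    simp only [Quaternion.re_mul, Quaternion.imI_mul, Quaternion.imJ_mul, Quaternion.imK_mul] <;>
    simp [e2]

lemma e1_mul_e2 : e1 * e2 = -(e2 * e1) := by
  ext <;>
    simp only [Quaternion.re_neg, Quaternion.imI_neg, Quaternion.imJ_neg, Quaternion.imK_neg,
      Quaternion.re_mul, Quaternion.imI_mul, Quaternion.imJ_mul, Quaternion.imK_mul] <;>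
    simp [e1, e2]

lemma sandwichBar_eq_dirac {Ω : Set R3} (hΩ : IsOpen Ω) {f : R3 → ℍ[ℝ]}
    (hf : ContDiffOn ℝ 2 f Ω) {x : R3} (hx : x ∈ Ω) :
    sandwichBar f x = dirac (mulL e1) (mulL e2) (dirac (mulR e1) (mulR e2) f) x := by
  rw [dirac]
  simp [pd_dirac hΩ _ _ hf hx, sandwichBar, Fin.sum_univ_three, eu, mulL_apply, mulR_apply,
    mul_add, mul_assoc]

lemma sandwich_eq_dirac {Ω : Set R3} (hΩ : IsOpen Ω) {f : R3 → ℍ[ℝ]}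
    (hf : ContDiffOn ℝ 2 f Ω) {x : R3} (hx : x ∈ Ω) :
    sandwich f x = dirac (mulL (-e1)) (mulL (-e2)) (dirac (mulR (-e1)) (mulR (-e2)) f) x := by
  rw [dirac]
  simp [pd_dirac hΩ _ _ hf hx, sandwich, Fin.sum_univ_three, eu, eps, mulL_apply, mulR_apply,
    mul_add, mul_assoc]

lemma lap_lap_eq_zero_of_mul_dirac {Ω : Set R3} (hΩ : IsOpen Ω) {a b : ℍ[ℝ]}
    (ha : a * a = -1) (hb : b * b = -1) (hab : a * b = -(b * a)) {f : R3 → ℍ[ℝ]}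
    (hf : ContDiffOn ℝ 4 f Ω)
    (h : ∀ x ∈ Ω, dirac (mulL a) (mulL b) (dirac (mulR a) (mulR b) f) x = 0) :
    ∀ x ∈ Ω, lap (lap f) x = 0 := by
  refine lap_lap_eq_zero_of_dirac_dirac hΩ ?_ ?_ ?_ ?_ ?_ ?_ hf h <;> intro v
  · simp [mulL_apply, ← mul_assoc, ha]
  · simp [mulL_apply, ← mul_assoc, hb]
  · simp [mulL_apply, ← mul_assoc, hab]
  · simp [mulR_apply, mul_assoc, ha]
  · simp [mulR_apply, mul_assoc, hb]
  · simp [mulR_apply, mul_assoc, hab]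

lemma lap_lap_eq_zero_of_sandwich {Ω : Set R3} (hΩ : IsOpen Ω) {f : R3 → ℍ[ℝ]}
    (hf : ContDiffOn ℝ 4 f Ω)
    (h : (∀ x ∈ Ω, sandwichBar f x = 0) ∨ (∀ x ∈ Ω, sandwich f x = 0)) :
    ∀ x ∈ Ω, lap (lap f) x = 0 := by
  have hf2 : ContDiffOn ℝ 2 f Ω := hf.of_le (by norm_num)
  rcases h with h | h
  · exact lap_lap_eq_zero_of_mul_dirac hΩ e1_mul_e1 e2_mul_e2 e1_mul_e2 hf
      fun x hx => (sandwichBar_eq_dirac hΩ hf2 hx).symm.trans (h x hx)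
  · exact lap_lap_eq_zero_of_mul_dirac hΩ (by rw [neg_mul_neg, e1_mul_e1])
      (by rw [neg_mul_neg, e2_mul_e2]) (by rw [neg_mul_neg, neg_mul_neg, e1_mul_e2]) hf
      fun x hx => (sandwich_eq_dirac hΩ hf2 hx).symm.trans (h x hx)

/-- The component `re` of a quaternion as a continuous linear map. -/
def reCLM : ℍ[ℝ] →L[ℝ] ℝ where
  toFun q := q.re
  map_add' _ _ := rfl
  map_smul' _ _ := rfl
  cont := Quaternion.continuous_re

/-- The component `imI` of a quaternion as a continuous linear map. -/
def imICLM : ℍ[ℝ] →L[ℝ] ℝ where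
  toFun q := q.imI
  map_add' _ _ := rfl
  map_smul' _ _ := rfl
  cont := Quaternion.continuous_imI

/-- The component `imJ` of a quaternion as a continuous linear map. -/
def imJCLM : ℍ[ℝ] →L[ℝ] ℝ where
  toFun q := q.imJ
  map_add' _ _ := rfl
  map_smul' _ _ := rfl
  cont := Quaternion.continuous_imJ

/-- The component `imK` of a quaternion as a continuous linear map. -/
def imKCLM : ℍ[ℝ] →L[ℝ] ℝ where
  toFun q := q.imK
  map_add' _ _ := rfl
  map_smul' _ _ := rfl
  cont := Quaternion.continuous_imK

/-- If a C⁴ function `f : Ω → ℍ` is inframonogenic or antiinframonogenic,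
then each of its four real components is biharmonic. -/
theorem stmt1 (Ω : Set R3) (hΩ : IsOpen Ω) (f : R3 → ℍ[ℝ])
    (hf : ContDiffOn ℝ 4 f Ω)
    (h : (∀ x ∈ Ω, sandwichBar f x = 0) ∨ (∀ x ∈ Ω, sandwich f x = 0)) :
    ∀ x ∈ Ω,
      lap (lap fun y => (f y).re) x = 0 ∧
      lap (lap fun y => (f y).imI) x = 0 ∧
      lap (lap fun y => (f y).imJ) x = 0 ∧
      lap (lap fun y => (f y).imK) x = 0 := by
  intro x hx
  have h0 := lap_lap_eq_zero_of_sandwich hΩ hf h x hx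
  exact ⟨
    lap_lap_clm_eq_zero hΩ reCLM hf hx h0,
    lap_lap_clm_eq_zero hΩ imICLM hf hx h0,
    lap_lap_clm_eq_zero hΩ imJCLM hf hx h0,
    lap_lap_clm_eq_zero hΩ imKCLM hf hx h0⟩
end
end

section
/- Let Ω ⊆ ℝ³ be open and let f = f₀ + f₁e₁ + f₂e₂ and g = g₀ + g₁e₁ + g₂e₂ be C¹ reduced-quaternion-valued functions on Ω. Then the following Leibniz rules hold for the left Cauchy–Riemann operators: ∂̄(fg) = (∂̄f)g + f(∂̄g) − 2e₃(f₁(∂₂g) − f₂(∂₁g)) and ∂(fg) = (∂f)g + f(∂g) + 2e₃(f₁(∂₂g) − f₂(∂₁g)), where the quaternion product fg is taken pointwise. -/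
open Quaternion

noncomputable section

/-- The product rule for the partial derivatives of quaternion-valued functions. -/
theorem pd_mul {f g : R3 → ℍ[ℝ]} {x : R3} (hf : DifferentiableAt ℝ f x)
    (hg : DifferentiableAt ℝ g x) (i : Fin 3) :
    pd i (fun y => f y * g y) x = pd i f x * g x + f x * pd i g x := by
  simp only [pd, fderiv_fun_mul' hf hg]
  simp [add_comm]

@[simp] theorem re_e1 : e1.re = 0 := rfl
@[simp] theorem imI_e1 : e1.imI = 1 := rfl
@[simp] theorem imJ_e1 : e1.imJ = 0 := rfl
@[simp] theorem imK_e1 : e1.imK = 0 := rfl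

@[simp] theorem re_e2 : e2.re = 0 := rfl
@[simp] theorem imI_e2 : e2.imI = 0 := rfl
@[simp] theorem imJ_e2 : e2.imJ = 1 := rfl
@[simp] theorem imK_e2 : e2.imK = 0 := rfl

@[simp] theorem re_e3 : e3.re = 0 := rfl
@[simp] theorem imI_e3 : e3.imI = 0 := rfl
@[simp] theorem imJ_e3 : e3.imJ = 0 := rfl
@[simp] theorem imK_e3 : e3.imK = 1 := rfl

theorem e1_mul_of_imK_eq_zero {a : ℍ[ℝ]} (ha : a.imK = 0) :
    e1 * a = a * e1 + (2 * a.imJ) • e3 := by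
  ext <;> simp [ha]
  ring

theorem e2_mul_of_imK_eq_zero {a : ℍ[ℝ]} (ha : a.imK = 0) :
    e2 * a = a * e2 - (2 * a.imI) • e3 := by
  ext <;> simp [ha]
  ring

/-- Leibniz rules for the left Cauchy–Riemann operators applied to a
pointwise product of C¹ reduced-quaternion-valued functions:
`∂̄(fg) = (∂̄f)g + f(∂̄g) − 2e₃(f₁(∂₂g) − f₂(∂₁g))` and
`∂(fg) = (∂f)g + f(∂g) + 2e₃(f₁(∂₂g) − f₂(∂₁g))`. -/
theorem stmt9 (Ω : Set R3) (hΩ : IsOpen Ω) (f g : R3 → ℍ[ℝ])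
    (hf : ContDiffOn ℝ 1 f Ω) (hg : ContDiffOn ℝ 1 g Ω)
    (hfred : ∀ x ∈ Ω, (f x).imK = 0) (hgred : ∀ x ∈ Ω, (g x).imK = 0) :
    ∀ x ∈ Ω,
      DbarL (fun y => f y * g y) x
        = DbarL f x * g x + f x * DbarL g x
          - 2 * (e3 * ((f x).imI • pd 2 g x - (f x).imJ • pd 1 g x)) ∧
      DL (fun y => f y * g y) x
        = DL f x * g x + f x * DL g x
          + 2 * (e3 * ((f x).imI • pd 2 g x - (f x).imJ • pd 1 g x)) := by
  intro x hx
  have hfx : DifferentiableAt ℝ f x :=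
    (hf.contDiffAt (hΩ.mem_nhds hx)).differentiableAt one_ne_zero
  have hgx : DifferentiableAt ℝ g x :=
    (hg.contDiffAt (hΩ.mem_nhds hx)).differentiableAt one_ne_zero
  have h1 (b : ℍ[ℝ]) : e1 * (f x * b) = f x * (e1 * b) + (2 * (f x).imJ) • (e3 * b) := by
    rw [← mul_assoc, e1_mul_of_imK_eq_zero (hfred x hx), add_mul, mul_assoc, smul_mul_assoc]
  have h2 (b : ℍ[ℝ]) : e2 * (f x * b) = f x * (e2 * b) - (2 * (f x).imI) • (e3 * b) := by
    rw [← mul_assoc, e2_mul_of_imK_eq_zero (hfred x hx), sub_mul, mul_assoc, smul_mul_assoc]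
  simp only [DbarL, DL, pd_mul hfx hgx, mul_add, add_mul, mul_sub, sub_mul, h1, h2, mul_assoc,
    mul_smul_comm, two_mul, add_smul]
  constructor <;> module
end
end
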